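/- Let p > 1. There exists a constant C = C(p) > 0 such that for every nonnegative function ω ∈ L¹ ∩ L^p(ℝ²₊) with ‖ω‖_{L¹} ≤ 1 and x₂ω ∈ L¹(ℝ²₊), the penalized energy satisfies E_p(ω) := E(ω) − (1/p)‖ω‖_{L^p}^p ≤ C · ‖x₂ω‖_{L¹}^{(2p−2)/(2p−1)}. -/

import Mathlib

open MeasureTheory Real Set

noncomputable def G (x y : ℝ × ℝ) : ℝ :=
  (1 / (4 * π)) * Real.log (1 + 4 * x.2 * y.2 / ((x.1 - y.1)^2 + (x.2 - y.2)^2))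

def upperHalf : Set (ℝ × ℝ) := {y : ℝ × ℝ | 0 < y.2}

noncomputable def energy (ω : ℝ × ℝ → ℝ) : ℝ :=
  (1/2) * ∫ x in upperHalf, ∫ y in upperHalf, G x y * ω x * ω y

noncomputable def penEnergy (p : ℝ) (ω : ℝ × ℝ → ℝ) : ℝ :=
  energy ω - (1/p) * ∫ x in upperHalf, ω x ^ p

lemma log_one_add_le_rpow_div {s α : ℝ} (hs : 0 ≤ s) (h0 : 0 < α) (h1 : α ≤ 1) :
    Real.log (1 + s) ≤ s ^ α / α := by
  have hpow : (1 + s) ^ α ≤ 1 + s ^ α := by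
    simpa using Real.rpow_add_le_add_rpow zero_le_one hs h0.le h1
  have hlog : Real.log ((1 + s) ^ α) ≤ s ^ α := by
    have := Real.log_le_sub_one_of_pos (Real.rpow_pos_of_pos (by linarith : 0 < 1 + s) α)
    linarith
  rw [Real.log_rpow (by linarith)] at hlog
  rw [le_div_iff₀ h0]
  linarith

lemma G_nonneg {x y : ℝ × ℝ} (hx : 0 < x.2) (hy : 0 < y.2) : 0 ≤ G x y := by
  unfold G
  have : 0 ≤ 4 * x.2 * y.2 / ((x.1 - y.1)^2 + (x.2 - y.2)^2) := by positivity
  exact mul_nonneg (by positivity) (Real.log_nonneg (by linarith))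

lemma G_le_rpow {x y : ℝ × ℝ} (hx : 0 < x.2) (hy : 0 < y.2) {α : ℝ} (h0 : 0 < α) (h1 : α ≤ 1) :
    G x y ≤ α⁻¹ * (x.2 ^ α * ‖x - y‖ ^ (-α)) := by
  rcases eq_or_ne x y with rfl | hxy
  · simp only [G, sub_self]
    norm_num
    positivity
  have hd : 0 < ‖x - y‖ := norm_pos_iff.2 (sub_ne_zero.2 hxy)
  set d := ‖x - y‖ with hd_def
  have hsq : d ^ 2 ≤ (x.1 - y.1)^2 + (x.2 - y.2)^2 := by
    rw [hd_def, Prod.norm_def]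
    rcases max_choice ‖(x - y).1‖ ‖(x - y).2‖ with h | h <;> rw [h] <;>
      simp only [Prod.fst_sub, Prod.snd_sub, Real.norm_eq_abs, sq_abs] <;>
      nlinarith [sq_nonneg (x.1 - y.1), sq_nonneg (x.2 - y.2)]
  have hy2 : y.2 ≤ x.2 + d := by
    have h := (norm_snd_le (x - y)).trans hd_def.ge
    rw [Prod.snd_sub, Real.norm_eq_abs] at h
    linarith [neg_abs_le (x.2 - y.2)]
  have harg : 1 + 4 * x.2 * y.2 / ((x.1 - y.1)^2 + (x.2 - y.2)^2) ≤ (1 + 2 * (x.2 / d)) ^ 2 := by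
    have e : (1 + 2 * (x.2 / d)) ^ 2 = 1 + 4 * x.2 * (x.2 + d) / d ^ 2 := by field_simp; ring
    rw [e]
    gcongr
  have hlog : Real.log (1 + 4 * x.2 * y.2 / ((x.1 - y.1)^2 + (x.2 - y.2)^2))
      ≤ 2 * ((2 * (x.2 / d)) ^ α / α) := by
    calc _ ≤ Real.log ((1 + 2 * (x.2 / d)) ^ 2) := Real.log_le_log (by positivity) harg
      _ = 2 * Real.log (1 + 2 * (x.2 / d)) := by rw [Real.log_pow]; norm_num
      _ ≤ _ := by
        gcongr
        exact log_one_add_le_rpow_div (by positivity) h0 h1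
  have h2 : (2 : ℝ) ^ α ≤ 2 := by
    simpa using Real.rpow_le_rpow_of_exponent_le one_le_two h1
  have hpi : 1 / (4 * π) * 4 ≤ 1 := by
    rw [div_mul_eq_mul_div, div_le_one (by positivity)]
    linarith [Real.pi_gt_three]
  have e : x.2 ^ α * d ^ (-α) = (x.2 / d) ^ α := by
    rw [Real.div_rpow hx.le hd.le, Real.rpow_neg hd.le, div_eq_mul_inv]
  rw [Real.mul_rpow zero_le_two (by positivity)] at hlog
  rw [e, G]
  calc _ ≤ 1 / (4 * π) * (2 * (2 * (x.2 / d) ^ α / α)) := by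
        refine mul_le_mul_of_nonneg_left (hlog.trans ?_) (by positivity)
        gcongr
    _ = (1 / (4 * π) * 4) * (α⁻¹ * (x.2 / d) ^ α) := by ring
    _ ≤ 1 * (α⁻¹ * (x.2 / d) ^ α) := by gcongr
    _ = _ := one_mul _

lemma volume_real_ball_zero_one_prod : volume.real (Metric.ball (0 : ℝ × ℝ) 1) = 4 := by
  have : Metric.ball (0 : ℝ × ℝ) 1 = Metric.ball (0 : ℝ) 1 ×ˢ Metric.ball (0 : ℝ) 1 :=
    (ball_prod_same 0 0 1).symm
  rw [this, Measure.volume_eq_prod, measureReal_prod_prod, Real.volume_real_ball zero_le_one]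
  norm_num

lemma integrable_indicator_inv_norm (R : ℝ) :
    Integrable (fun z : ℝ × ℝ => (Iio R).indicator (fun r : ℝ => r⁻¹) ‖z‖) := by
  rw [integrable_fun_norm_addHaar volume (f := (Iio R).indicator (fun r : ℝ => r⁻¹))]
  have h : IntegrableOn ((Iio R).indicator (fun _ : ℝ => (1 : ℝ))) (Ioi 0) := by
    rw [integrableOn_indicator_iff measurableSet_Iio, inter_comm, Ioi_inter_Iio]
    exact integrableOn_const (by simp)
  refine h.congr_fun (fun r hr => ?_) measurableSet_Ioi
  have : r ≠ 0 := (mem_Ioi.1 hr).ne'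
  by_cases hR : r ∈ Iio R <;> simp [hR, this]

lemma integral_indicator_inv_norm {R : ℝ} (hR : 0 ≤ R) :
    ∫ z : ℝ × ℝ, (Iio R).indicator (fun r : ℝ => r⁻¹) ‖z‖ = 8 * R := by
  rw [integral_fun_norm_addHaar volume ((Iio R).indicator (fun r : ℝ => r⁻¹)),
    volume_real_ball_zero_one_prod]
  have h : ∫ y in Ioi (0 : ℝ), y ^ (Module.finrank ℝ (ℝ × ℝ) - 1) •
      (Iio R).indicator (fun r : ℝ => r⁻¹) y = ∫ y in Ioi (0 : ℝ), (Iio R).indicator 1 y := by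
    refine setIntegral_congr_fun measurableSet_Ioi (fun r hr => ?_)
    have : r ≠ 0 := (mem_Ioi.1 hr).ne'
    by_cases hR : r ∈ Iio R <;> simp [hR, this]
  rw [h, setIntegral_indicator measurableSet_Iio]
  simp [Ioi_inter_Iio, hR]
  ring

lemma measurableSet_upperHalf : MeasurableSet upperHalf :=
  measurableSet_lt measurable_const measurable_snd

lemma mul_rpow_neg_le {p : ℝ} (hp : 1 < p) {w d R A : ℝ} (hw : 0 ≤ w) (hd : 0 ≤ d) (hR : 0 < R)
    (hA : 0 < A) :
    w * d ^ (-((p - 1) / p)) ≤ R ^ (-((p - 1) / p)) * w + (p * A)⁻¹ * w ^ p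
      + A ^ (1 / (p - 1)) * (Iio R).indicator (fun r : ℝ => r⁻¹) d := by
  have hp0 : 0 < p := by linarith
  have hp1 : 0 < p - 1 := by linarith
  by_cases hdR : d < R
  · rw [indicator_of_mem (mem_Iio.2 hdR)]
    have hq := Real.HolderConjugate.conjExponent hp
    have hy := Real.young_inequality_of_nonneg (a := A ^ (-(1 / p)) * w)
      (b := A ^ (1 / p) * d ^ (-((p - 1) / p))) (by positivity) (by positivity) hq
    have e1 : A ^ (-(1 / p)) * w * (A ^ (1 / p) * d ^ (-((p - 1) / p)))
        = w * d ^ (-((p - 1) / p)) := by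
      have : A ^ (-(1 / p)) * A ^ (1 / p) = 1 := by rw [← Real.rpow_add hA]; simp
      linear_combination (w * d ^ (-((p - 1) / p))) * this
    have e2 : (A ^ (-(1 / p)) * w) ^ p / p = (p * A)⁻¹ * w ^ p := by
      rw [Real.mul_rpow (by positivity) hw, ← Real.rpow_mul hA.le,
        show -(1 / p) * p = -1 by field_simp, Real.rpow_neg_one]
      field_simp
    have e3 : (A ^ (1 / p) * d ^ (-((p - 1) / p))) ^ Real.conjExponent p
        = A ^ (1 / (p - 1)) * d⁻¹ := by
      rw [Real.mul_rpow (by positivity) (by positivity), ← Real.rpow_mul hA.le,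
        ← Real.rpow_mul hd, Real.conjExponent, ← Real.rpow_neg_one d]
      congr 2 <;> field_simp
    rw [e1, e2, e3] at hy
    have h4 : A ^ (1 / (p - 1)) * d⁻¹ / Real.conjExponent p ≤ A ^ (1 / (p - 1)) * d⁻¹ :=
      div_le_self (by positivity) hq.symm.lt.le
    have : 0 ≤ R ^ (-((p - 1) / p)) * w := by positivity
    linarith
  · rw [indicator_of_notMem (by simpa using hdR), mul_zero, add_zero]
    have h1 : d ^ (-((p - 1) / p)) ≤ R ^ (-((p - 1) / p)) :=
      Real.rpow_le_rpow_of_nonpos hR (not_lt.1 hdR) (by rw [neg_nonpos]; positivity)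
    have h2 : 0 ≤ (p * A)⁻¹ * w ^ p := by positivity
    nlinarith [mul_le_mul_of_nonneg_left h1 hw]

section

variable {p : ℝ} {ω : ℝ × ℝ → ℝ}

lemma integral_G_mul_le (hp : 1 < p) (hω : ∀ y, 0 ≤ ω y) (h1 : IntegrableOn ω upperHalf)
    (hpi : IntegrableOn (fun y => ω y ^ p) upperHalf) (hm : ∫ y in upperHalf, ω y ≤ 1)
    {R A : ℝ} (hR : 0 < R) (hA : 0 < A) {x : ℝ × ℝ} (hx : x ∈ upperHalf) :
    ∫ y in upperHalf, G x y * ω x * ω y ≤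
      ((p - 1) / p)⁻¹ * (R ^ (-((p - 1) / p)) + (p * A)⁻¹ * (∫ y in upperHalf, ω y ^ p)
        + A ^ (1 / (p - 1)) * (8 * R)) * (x.2 ^ ((p - 1) / p) * ω x) := by
  have hp0 : 0 < p := by linarith
  have hp1 : 0 < p - 1 := by linarith
  set α := (p - 1) / p with hα
  have hα0 : 0 < α := by positivity
  have hα1 : α ≤ 1 := by rw [hα, div_le_one hp0]; linarith
  have hx2 : 0 < x.2 := hx
  have hωx := hω x
  set k : ℝ × ℝ → ℝ := fun y => (Iio R).indicator (fun r : ℝ => r⁻¹) ‖y - x‖ with hk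
  have hk0 : ∀ y, 0 ≤ k y := fun y => by
    by_cases h : ‖y - x‖ ∈ Iio R <;> simp [hk, h]
  have hki : Integrable k := (integrable_indicator_inv_norm R).comp_sub_right x
  have hkI : ∫ y in upperHalf, k y ≤ 8 * R := by
    rw [← integral_indicator_inv_norm hR.le,
      ← integral_sub_right_eq_self
        (fun z : ℝ × ℝ => (Iio R).indicator (fun r : ℝ => r⁻¹) ‖z‖) x]
    exact setIntegral_le_integral hki (Filter.Eventually.of_forall hk0)
  have hi1 := h1.const_mul (R ^ (-α))
  have hi2 := hpi.const_mul ((p * A)⁻¹)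
  have hi3 := (hki.integrableOn (s := upperHalf)).const_mul (A ^ (1 / (p - 1)))
  have hi12 : IntegrableOn (fun y => R ^ (-α) * ω y + (p * A)⁻¹ * ω y ^ p) upperHalf := hi1.add hi2
  set c := α⁻¹ * (x.2 ^ α * ω x) with hc
  have hc0 : 0 ≤ c := by positivity
  have hmono : ∫ y in upperHalf, G x y * ω x * ω y ≤ ∫ y in upperHalf,
      c * (R ^ (-α) * ω y + (p * A)⁻¹ * ω y ^ p + A ^ (1 / (p - 1)) * k y) := by
    refine integral_mono_of_nonneg ?_ ((hi12.add hi3).const_mul c) ?_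
    · refine ae_restrict_of_forall_mem measurableSet_upperHalf fun y hy => ?_
      exact mul_nonneg (mul_nonneg (G_nonneg hx2 hy) hωx) (hω y)
    · refine ae_restrict_of_forall_mem measurableSet_upperHalf fun y hy => ?_
      have hG := mul_le_mul_of_nonneg_right (G_le_rpow hx2 hy hα0 hα1) (mul_nonneg hωx (hω y))
      have hY := mul_le_mul_of_nonneg_left
        (mul_rpow_neg_le hp (hω y) (norm_nonneg (y - x)) hR hA) hc0
      calc G x y * ω x * ω y = G x y * (ω x * ω y) := mul_assoc _ _ _
        _ ≤ _ := hG
        _ = c * (ω y * ‖y - x‖ ^ (-α)) := by rw [norm_sub_rev, hc]; ring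
        _ ≤ _ := hY
  refine hmono.trans ?_
  rw [integral_const_mul, integral_add hi12 hi3, integral_add hi1 hi2, integral_const_mul,
    integral_const_mul, integral_const_mul]
  have hRm : R ^ (-α) * ∫ y in upperHalf, ω y ≤ R ^ (-α) :=
    mul_le_of_le_one_right (by positivity) hm
  have hAk := mul_le_mul_of_nonneg_left hkI (by positivity : 0 ≤ A ^ (1 / (p - 1)))
  calc _ ≤ c * (R ^ (-α) + (p * A)⁻¹ * (∫ y in upperHalf, ω y ^ p)
        + A ^ (1 / (p - 1)) * (8 * R)) := by gcongr
    _ = _ := by rw [hc]; ring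

lemma rpow_le_rpow_mul_add {a I α : ℝ} (ha : 0 ≤ a) (hI : 0 < I) (h0 : 0 ≤ α) (h1 : α ≤ 1) :
    a ^ α ≤ I ^ α * (I⁻¹ * a + 1) := by
  have hu : (I⁻¹ * a) ^ α ≤ I⁻¹ * a + 1 := by
    have hu0 : 0 ≤ I⁻¹ * a := by positivity
    rcases le_total (I⁻¹ * a) 1 with h | h
    · linarith [Real.rpow_le_one hu0 h h0]
    · have := Real.rpow_le_rpow_of_exponent_le h h1
      rw [Real.rpow_one] at this
      linarith
  calc a ^ α = I ^ α * (I⁻¹ * a) ^ α := by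
        rw [← Real.mul_rpow hI.le (by positivity), mul_inv_cancel_left₀ hI.ne']
    _ ≤ _ := by gcongr

lemma energy_le (hp : 1 < p) (hω : ∀ y, 0 ≤ ω y) (h1 : IntegrableOn ω upperHalf)
    (hpi : IntegrableOn (fun y => ω y ^ p) upperHalf)
    (hxi : IntegrableOn (fun y => y.2 * ω y) upperHalf) (hm : ∫ y in upperHalf, ω y ≤ 1)
    {R A : ℝ} (hR : 0 < R) (hA : 0 < A) (hI : 0 < ∫ y in upperHalf, y.2 * ω y) :
    energy ω ≤ ((p - 1) / p)⁻¹ * (R ^ (-((p - 1) / p)) + (p * A)⁻¹ * (∫ y in upperHalf, ω y ^ p)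
        + A ^ (1 / (p - 1)) * (8 * R)) * (∫ y in upperHalf, y.2 * ω y) ^ ((p - 1) / p) := by
  have hp0 : 0 < p := by linarith
  have hp1 : 0 < p - 1 := by linarith
  set α := (p - 1) / p with hα
  have hα0 : 0 < α := by positivity
  have hα1 : α ≤ 1 := by rw [hα, div_le_one hp0]; linarith
  set I := ∫ y in upperHalf, y.2 * ω y with hIdef
  have hQ : 0 ≤ ∫ y in upperHalf, ω y ^ p := integral_nonneg fun y => Real.rpow_nonneg (hω y) p
  set K := α⁻¹ * (R ^ (-α) + (p * A)⁻¹ * (∫ y in upperHalf, ω y ^ p)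
        + A ^ (1 / (p - 1)) * (8 * R)) with hK
  have hK0 : 0 ≤ K := by positivity
  have hi := hxi.const_mul I⁻¹
  have hmono : ∫ x in upperHalf, ∫ y in upperHalf, G x y * ω x * ω y ≤
      ∫ x in upperHalf, K * I ^ α * (I⁻¹ * (x.2 * ω x) + ω x) := by
    refine integral_mono_of_nonneg ?_ ((hi.add h1).const_mul _) ?_
    · refine ae_restrict_of_forall_mem measurableSet_upperHalf fun x hx => ?_
      exact setIntegral_nonneg measurableSet_upperHalf fun y hy =>
        mul_nonneg (mul_nonneg (G_nonneg hx hy) (hω x)) (hω y)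
    · refine ae_restrict_of_forall_mem measurableSet_upperHalf fun x hx => ?_
      have hx2 : 0 < x.2 := hx
      have hωx := hω x
      calc _ ≤ K * (x.2 ^ α * ω x) := integral_G_mul_le hp hω h1 hpi hm hR hA hx
        _ ≤ K * (I ^ α * (I⁻¹ * x.2 + 1) * ω x) := by
          gcongr
          exact rpow_le_rpow_mul_add hx2.le hI hα0.le hα1
        _ = _ := by ring
  rw [integral_const_mul, integral_add hi h1, integral_const_mul, ← hIdef,
    inv_mul_cancel₀ hI.ne'] at hmono
  have : K * I ^ α * (1 + ∫ y in upperHalf, ω y) ≤ K * I ^ α * 2 := by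
    gcongr
    linarith
  rw [energy]
  linarith

lemma energy_eq_zero (hω : ∀ y, 0 ≤ ω y)
    (hxi : IntegrableOn (fun y => y.2 * ω y) upperHalf)
    (hI : ∫ y in upperHalf, y.2 * ω y = 0) : energy ω = 0 := by
  have hae : ∀ᵐ y ∂volume.restrict upperHalf, ω y = 0 := by
    rw [setIntegral_eq_zero_iff_of_nonneg_ae (ae_restrict_of_forall_mem measurableSet_upperHalf
      fun y hy => mul_nonneg (le_of_lt hy) (hω y)) hxi] at hI
    filter_upwards [hI, ae_restrict_mem measurableSet_upperHalf] with y hy hmem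
    exact (mul_eq_zero.1 hy).resolve_left (ne_of_gt hmem)
  have h0 : ∫ x in upperHalf, ∫ y in upperHalf, G x y * ω x * ω y = 0 := by
    refine integral_eq_zero_of_ae ?_
    filter_upwards [hae] with x hx
    simp [hx]
  rw [energy, h0, mul_zero]

end

theorem penalized_energy_impulse_bound (p : ℝ) (hp : 1 < p) :
    ∃ C : ℝ, 0 < C ∧ ∀ ω : ℝ × ℝ → ℝ, (∀ y, 0 ≤ ω y) →
      IntegrableOn ω upperHalf → IntegrableOn (fun y => ω y ^ p) upperHalf →
      IntegrableOn (fun y => y.2 * ω y) upperHalf →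
      (∫ y in upperHalf, ω y) ≤ 1 →
      penEnergy p ω ≤ C * (∫ y in upperHalf, y.2 * ω y) ^ ((2 * p - 2) / (2 * p - 1)) := by
  have hp0 : 0 < p := by linarith
  have hp1 : 0 < p - 1 := by linarith
  have hp2 : 0 < 2 * p - 1 := by linarith
  set α := (p - 1) / p with hα
  have hα0 : 0 < α := by positivity
  refine ⟨α⁻¹ * (1 + (α⁻¹) ^ (1 / (p - 1)) * 8), by positivity, ?_⟩
  intro ω hω h1 hpi hxi hm
  have hQ : 0 ≤ ∫ y in upperHalf, ω y ^ p := integral_nonneg fun y => Real.rpow_nonneg (hω y) p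
  have hI0 : 0 ≤ ∫ y in upperHalf, y.2 * ω y :=
    setIntegral_nonneg measurableSet_upperHalf fun y hy => mul_nonneg (le_of_lt hy) (hω y)
  rcases hI0.eq_or_lt with hI | hI
  · rw [penEnergy, energy_eq_zero hω hxi hI.symm]
    have : 0 ≤ 1 / p * ∫ y in upperHalf, ω y ^ p := by positivity
    have : 0 ≤ α⁻¹ * (1 + (α⁻¹) ^ (1 / (p - 1)) * 8) *
        (∫ y in upperHalf, y.2 * ω y) ^ ((2 * p - 2) / (2 * p - 1)) := by positivity
    linarith
  have hE := energy_le hp hω h1 hpi hxi hm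
    (R := (∫ y in upperHalf, y.2 * ω y) ^ (-(1 / (2 * p - 1))))
    (A := α⁻¹ * (∫ y in upperHalf, y.2 * ω y) ^ α) (by positivity) (by positivity) hI
  rw [← hα] at hE
  rw [penEnergy]
  set I := ∫ y in upperHalf, y.2 * ω y
  set Q := ∫ y in upperHalf, ω y ^ p
  have e1 : (I ^ (-(1 / (2 * p - 1)))) ^ (-α) * I ^ α = I ^ ((2 * p - 2) / (2 * p - 1)) := by
    rw [← Real.rpow_mul hI.le, ← Real.rpow_add hI]
    congr 1
    rw [hα]
    field_simp
    ring
  have e2 : α⁻¹ * ((p * (α⁻¹ * I ^ α))⁻¹ * Q) * I ^ α = 1 / p * Q := by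
    have : 0 < I ^ α := by positivity
    field_simp
  have e3 : (α⁻¹ * I ^ α) ^ (1 / (p - 1)) * I ^ (-(1 / (2 * p - 1))) * I ^ α
      = (α⁻¹) ^ (1 / (p - 1)) * I ^ ((2 * p - 2) / (2 * p - 1)) := by
    rw [Real.mul_rpow (by positivity) (by positivity), ← Real.rpow_mul hI.le, mul_assoc, mul_assoc,
      ← Real.rpow_add hI, ← Real.rpow_add hI]
    have hαp : α * (1 / (p - 1)) = 1 / p := by
      rw [hα]
      field_simp
    congr 2
    rw [hαp, hα, show 2 * p - 2 = 2 * p - 1 - 1 by ring, sub_div _ _ (2 * p - 1), div_self hp2.ne',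
      sub_div, div_self hp0.ne']
    ring
  linear_combination hE + α⁻¹ * e1 + e2 + 8 * α⁻¹ * e3
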